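/- arXiv:1702.01945 — 5 statements merged into one kernel-verified Lean document; each statement's English description precedes it below -/
import Mathlib

section
/- For every natural number n ≥ 1 and every real number α, the product over k = 0, 1, …, n−1 of (1 + exp(i·(α + 2kπ/n))) equals 1 + exp(i·(nα + (n−1)π)). (This is the scalar identity expressing the soundness of the cyclotomic supplementarity rule SUP_n: merging n green dots whose angles α + 2kπ/n divide the circle into equal parts yields a single dot with angle nα + (n−1)π.) -/
open Complex Real

/-- Soundness of the cyclotomic supplementarity rule `SUP_n`:
for `n ≥ 1` and any real `α`,
`∏_{k=0}^{n-1} (1 + e^{i(α + 2kπ/n)}) = 1 + e^{i(nα + (n-1)π)}`. -/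
theorem cyclotomic_supplementarity_sound (n : ℕ) (hn : 1 ≤ n) (α : ℝ) :
    ∏ k ∈ Finset.range n,
      (1 + Complex.exp ((↑(α + 2 * k * Real.pi / n) : ℂ) * Complex.I)) =
    1 + Complex.exp ((↑((n : ℝ) * α + ((n : ℝ) - 1) * Real.pi) : ℂ) * Complex.I) := by
  have h0 : (n : ℂ) ≠ 0 := Nat.cast_ne_zero.mpr (by lia)
  have hfac := congrArg (Polynomial.eval 1) (X_pow_sub_C_eq_prod
    (Complex.isPrimitiveRoot_exp n (by lia)) (α := Complex.exp ((α + Real.pi) * Complex.I)) hn rfl)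
  simp only [Polynomial.eval_sub, Polynomial.eval_pow, Polynomial.eval_X, Polynomial.eval_C,
    one_pow, Polynomial.eval_prod, ← Complex.exp_nat_mul, ← Complex.exp_add] at hfac
  have hrhs : Complex.exp ((↑((n : ℝ) * α + ((n : ℝ) - 1) * Real.pi) : ℂ) * Complex.I) =
      -Complex.exp (n * ((α + Real.pi) * Complex.I)) := by
    rw [← Complex.exp_sub_pi_mul_I]
    push_cast
    ring_nf
  rw [hrhs, ← sub_eq_add_neg, hfac]
  refine Finset.prod_congr rfl fun k _ => ?_
  rw [sub_eq_add_neg, ← Complex.exp_sub_pi_mul_I]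
  push_cast
  congr 2
  field_simp
  ring
end

section
/- For every natural number k ≥ 1 with k not congruent to 0 modulo 4, the complex number √2 does not belong to the field ℚ(e^{iπ/k}). -/
open Complex IntermediateField

/-- `√2 ∉ ℚ(ζ)` for `ζ` a primitive root of unity whose order is `4` modulo `8`. -/
theorem sqrt_two_not_mem_adjoin_of_isPrimitiveRoot {ζ : ℂ} {m : ℕ}
    (hζ : IsPrimitiveRoot ζ (8 * m + 4)) :
    (Real.sqrt 2 : ℂ) ∉ IntermediateField.adjoin ℚ ({ζ} : Set ℂ) := by
  intro hmem
  have hcyc : IsCyclotomicExtension {8 * m + 4} ℚ (IntermediateField.adjoin ℚ ({ζ} : Set ℂ)) := by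
    change IsCyclotomicExtension {8 * m + 4} ℚ
      (IntermediateField.adjoin ℚ ({ζ} : Set ℂ)).toSubalgebra
    rw [IntermediateField.adjoin_simple_toSubalgebra_of_isAlgebraic
      (hζ.isIntegral (by omega)).tower_top.isAlgebraic]
    exact hζ.adjoin_isCyclotomicExtension ℚ
  have hfin : FiniteDimensional ℚ (IntermediateField.adjoin ℚ ({ζ} : Set ℂ)) :=
    IsCyclotomicExtension.finiteDimensional {8 * m + 4} ℚ _
  have hζmem : ζ ∈ IntermediateField.adjoin ℚ ({ζ} : Set ℂ) :=
    IntermediateField.mem_adjoin_simple_self ℚ ζ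
  have hζK : IsPrimitiveRoot (⟨ζ, hζmem⟩ : IntermediateField.adjoin ℚ ({ζ} : Set ℂ))
      (8 * m + 4) :=
    IsPrimitiveRoot.coe_submonoidClass_iff.mp hζ
  have hI : (ζ ^ (2 * m + 1)) ^ 2 = -1 := by
    rw [← pow_mul]
    refine IsPrimitiveRoot.eq_neg_one_of_two_right ?_
    exact hζ.pow (by omega) (by ring)
  obtain ⟨j, hj⟩ : ∃ j, j = ζ ^ (2 * m + 1) := ⟨_, rfl⟩
  rw [← hj] at hI
  have hjmem : j ∈ IntermediateField.adjoin ℚ ({ζ} : Set ℂ) := hj ▸ pow_mem hζmem _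
  have hsq : (Real.sqrt 2 : ℂ) ^ 2 = 2 := by
    rw [← Complex.ofReal_pow, Real.sq_sqrt (by norm_num)]
    norm_num
  have hxmem : (Real.sqrt 2 : ℂ) / 2 * (1 + j) ∈ IntermediateField.adjoin ℚ ({ζ} : Set ℂ) :=
    mul_mem (div_mem hmem (ofNat_mem _ 2)) (add_mem (one_mem _) hjmem)
  obtain ⟨x, hx⟩ : ∃ x : IntermediateField.adjoin ℚ ({ζ} : Set ℂ),
      (x : ℂ) = (Real.sqrt 2 : ℂ) / 2 * (1 + j) := ⟨⟨_, hxmem⟩, rfl⟩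
  have hx2 : (x : ℂ) ^ 2 = j := by
    rw [hx]
    linear_combination (1 + j) ^ 2 / 4 * hsq + hI / 2
  have hx4 : x ^ 4 = -1 := by
    apply Subtype.ext
    push_cast
    linear_combination ((x : ℂ) ^ 2 + j) * hx2 + hI
  have hx8 : IsPrimitiveRoot x 8 := by
    rw [show 8 = orderOf x from (orderOf_eq_prime_pow (p := 2) (n := 2) ?_ ?_).symm]
    · exact IsPrimitiveRoot.orderOf x
    · norm_num [hx4]
    · linear_combination (x ^ 4 - 1) * hx4
  have hle := hζK.lcm_totient_le_finrank hx8 (Polynomial.cyclotomic.irreducible_rat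
    (Nat.lcm_pos (by omega) (by omega)))
  have hlcm : Nat.lcm (8 * m + 4) 8 = 2 * (8 * m + 4) := by
    rw [show 8 * m + 4 = 4 * (2 * m + 1) by ring, show 8 = 4 * 2 by norm_num, Nat.lcm_mul_left,
      Nat.Coprime.lcm_eq_mul (by simp)]
    ring
  rw [IsCyclotomicExtension.finrank (n := 8 * m + 4) _
    (Polynomial.cyclotomic.irreducible_rat (by omega)), hlcm,
    Nat.totient_mul_of_prime_of_dvd Nat.prime_two (by omega)] at hle
  have hpos : 0 < Nat.totient (8 * m + 4) := Nat.totient_pos.mpr (by omega)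
  omega

/-- For `k ≥ 1` with `k ≢ 0 (mod 4)`, `√2 ∉ ℚ(e^{iπ/k})`. -/
theorem sqrt_two_not_mem_adjoin (k : ℕ) (hk : 1 ≤ k) (hk4 : k % 4 ≠ 0) :
    (Real.sqrt 2 : ℂ) ∉
      IntermediateField.adjoin ℚ ({Complex.exp (Real.pi * Complex.I / k)} : Set ℂ) := by
  have key : ∀ l : ℕ, l % 4 = 2 → (Real.sqrt 2 : ℂ) ∉
      IntermediateField.adjoin ℚ ({Complex.exp (Real.pi * Complex.I / l)} : Set ℂ) := by
    intro l hl
    have hζ : IsPrimitiveRoot (Complex.exp (Real.pi * Complex.I / l)) (8 * (l / 4) + 4) := by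
      have h := Complex.isPrimitiveRoot_exp (2 * l) (by omega)
      convert h using 2
      · push_cast
        rw [mul_assoc, mul_div_mul_left _ _ two_ne_zero]
      · omega
    exact sqrt_two_not_mem_adjoin_of_isPrimitiveRoot hζ
  by_cases h2 : k % 4 = 2
  · exact key k h2
  · intro hmem
    refine key (2 * k) (by omega) (IntermediateField.adjoin_simple_le_iff.mpr ?_ hmem)
    have hsq : Complex.exp (Real.pi * Complex.I / k) =
        Complex.exp (Real.pi * Complex.I / (2 * k : ℕ)) ^ 2 := by
      rw [← Complex.exp_nat_mul]
      congr 1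
      push_cast
      field_simp
    rw [hsq]
    exact pow_mem (IntermediateField.mem_adjoin_simple_self ℚ _) 2
end

section
/- The real number α₀ = π/2 − arccos(√(2/3)) is not a rational multiple of π: for every rational number q, π/2 − arccos(√(2/3)) ≠ q·π. -/
/-- `α₀ = π/2 − arccos(√(2/3))` is not a rational multiple of `π`. -/
theorem alpha_zero_not_rat_mul_pi (q : ℚ) :
    Real.pi / 2 - Real.arccos (Real.sqrt (2 / 3)) ≠ (q : ℝ) * Real.pi := by
  intro h
  have hsin : Real.sin (q * Real.pi) = Real.sqrt (2 / 3) := by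
    rw [← h, Real.sin_pi_div_two_sub, Real.cos_arccos]
    · linarith [Real.sqrt_nonneg (2 / 3)]
    · exact Real.sqrt_le_one.mpr (by norm_num)
  have hcos : Real.cos (2 * (q * Real.pi)) = -1 / 3 := by
    rw [Real.cos_two_mul, Real.cos_sq', hsin, Real.sq_sqrt (by norm_num)]
    norm_num
  have hniven := niven (θ := 2 * (q * Real.pi)) ⟨2 * q, by push_cast; ring⟩
    ⟨-1 / 3, by rw [hcos]; norm_num⟩
  rw [hcos] at hniven
  norm_num at hniven
end

section
/- Let H = (1/√2)·[[1,1],[1,−1]] be the 2×2 complex Hadamard matrix, and for a real β let Z(β) = [[1,0],[0,e^{iβ}]] and X(β) = H·Z(β)·H. Let α₀ = π/2 − arccos(√(2/3)) and θ₀ = arccos(√2/2 + √3/6). Then X(π/4)·Z(π/2)·X(π/4) = e^{iθ₀} · (Z(α₀)·X(π/3)·Z(α₀)) as 2×2 complex matrices. -/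
open Complex Real Matrix

/-- The 2×2 Hadamard matrix `H = (1/√2)·[[1,1],[1,−1]]`. -/
noncomputable def Hmat : Matrix (Fin 2) (Fin 2) ℂ :=
  ((1 / Real.sqrt 2 : ℝ) : ℂ) • !![1, 1; 1, -1]

/-- The green phase matrix `Z(β) = [[1,0],[0,e^{iβ}]]`. -/
noncomputable def Zmat (β : ℝ) : Matrix (Fin 2) (Fin 2) ℂ :=
  !![1, 0; 0, Complex.exp ((β : ℂ) * Complex.I)]

/-- The red phase matrix `X(β) = H·Z(β)·H`. -/
noncomputable def Xmat (β : ℝ) : Matrix (Fin 2) (Fin 2) ℂ :=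
  Hmat * Zmat β * Hmat

theorem exp_ofReal_mul_I_of_cos_of_sin {β c s : ℝ} (hc : Real.cos β = c) (hs : Real.sin β = s) :
    Complex.exp ((β : ℂ) * Complex.I) = c + s * Complex.I := by
  rw [Complex.exp_mul_I, ← Complex.ofReal_cos, ← Complex.ofReal_sin, hc, hs]

theorem exp_arccos_mul_I {c s : ℝ} (hs : 0 ≤ s) (h : c ^ 2 + s ^ 2 = 1) :
    Complex.exp ((Real.arccos c : ℂ) * Complex.I) = c + s * Complex.I := by
  apply exp_ofReal_mul_I_of_cos_of_sin
  · exact Real.cos_arccos (by nlinarith) (by nlinarith)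
  · rw [Real.sin_arccos, show 1 - c ^ 2 = s ^ 2 by linarith, Real.sqrt_sq hs]

theorem exp_pi_div_two_sub_arccos_mul_I {c s : ℝ} (hs : 0 ≤ s) (h : c ^ 2 + s ^ 2 = 1) :
    Complex.exp (((Real.pi / 2 - Real.arccos c : ℝ) : ℂ) * Complex.I) = s + c * Complex.I := by
  apply exp_ofReal_mul_I_of_cos_of_sin
  · rw [Real.cos_pi_div_two_sub, Real.sin_arccos, show 1 - c ^ 2 = s ^ 2 by linarith,
      Real.sqrt_sq hs]
  · rw [Real.sin_pi_div_two_sub]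
    exact Real.cos_arccos (by nlinarith) (by nlinarith)

theorem Xmat_eq (β : ℝ) {w : ℂ} (hw : Complex.exp ((β : ℂ) * Complex.I) = w) :
    Xmat β = !![(1 + w) / 2, (1 - w) / 2; (1 - w) / 2, (1 + w) / 2] := by
  have h : ((1 / Real.sqrt 2 : ℝ) : ℂ) * ((1 / Real.sqrt 2 : ℝ) : ℂ) = 1 / 2 := by
    rw [← Complex.ofReal_mul, div_mul_div_comm, Real.mul_self_sqrt zero_le_two]
    norm_num
  rw [Xmat, Hmat, Zmat, hw, Matrix.smul_mul, Matrix.smul_mul, Matrix.mul_smul, smul_smul, h]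
  ext i j
  fin_cases i <;> fin_cases j <;> simp <;> ring

/-- With `α₀ = π/2 − arccos(√(2/3))` and `θ₀ = arccos(√2/2 + √3/6)`, the matrices
`X(π/4)·Z(π/2)·X(π/4)` and `e^{iθ₀}·(Z(α₀)·X(π/3)·Z(α₀))` coincide:
that is, `⟦D₁⟧ = ⟦D₂⟧` in the incompleteness proof. -/
theorem D1_interp_eq_D2_interp :
    Xmat (Real.pi / 4) * Zmat (Real.pi / 2) * Xmat (Real.pi / 4) =
      Complex.exp ((↑(Real.arccos (Real.sqrt 2 / 2 + Real.sqrt 3 / 6)) : ℂ) * Complex.I) •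
        (Zmat (Real.pi / 2 - Real.arccos (Real.sqrt (2 / 3))) * Xmat (Real.pi / 3) *
          Zmat (Real.pi / 2 - Real.arccos (Real.sqrt (2 / 3)))) := by
  have hs : √2 ^ 2 = 2 := Real.sq_sqrt (by norm_num)
  have ht : √3 ^ 2 = 3 := Real.sq_sqrt (by norm_num)
  have hst : (√2 * √3) ^ 2 = 6 := by rw [mul_pow, hs, ht]; norm_num
  have hr : √(2 / 3) = √2 * √3 / 3 := by
    rw [Real.sqrt_eq_iff_mul_self_eq (by norm_num) (by positivity)]
    linear_combination -hst / 9
  have e2 := exp_ofReal_mul_I_of_cos_of_sin Real.cos_pi_div_two Real.sin_pi_div_two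
  have e3 := exp_ofReal_mul_I_of_cos_of_sin Real.cos_pi_div_three Real.sin_pi_div_three
  have e4 := exp_ofReal_mul_I_of_cos_of_sin Real.cos_pi_div_four Real.sin_pi_div_four
  have eα := exp_pi_div_two_sub_arccos_mul_I (c := √2 * √3 / 3) (s := √3 / 3) (by positivity)
    (by linear_combination hst / 9 + ht / 9)
  have eθ := exp_arccos_mul_I (c := √2 / 2 + √3 / 6) (s := 1 / 2 - √2 * √3 / 6)
    (by nlinarith) (by linear_combination hs / 4 + ht / 36 + hst / 36)
  rw [hr, Xmat_eq _ e3, Xmat_eq _ e4, Zmat, Zmat, e2, eα, eθ]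
  have hsC : (√2 : ℂ) ^ 2 = 2 := by exact_mod_cast hs
  have htC : (√3 : ℂ) ^ 2 = 3 := by exact_mod_cast ht
  have hI := Complex.I_sq
  push_cast
  generalize (√2 : ℂ) = s at *
  generalize (√3 : ℂ) = t at *
  ext i j
  fin_cases i <;> fin_cases j <;> simp <;> grind
end

section
/- For all real numbers α and θ, if (1/2)·e^{iθ}·(1 + e^{iπ/3})·(1 + e^{i(2α+π)}) = √2 (as complex numbers), then cos(α + π/2)² = 2/3. -/
open Complex Real

theorem Complex.normSq_exp_ofReal_mul_I (x : ℝ) :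
    Complex.normSq (Complex.exp ((x : ℂ) * Complex.I)) = 1 := by
  rw [Complex.normSq_eq_norm_sq, Complex.norm_exp_ofReal_mul_I, one_pow]

theorem Complex.normSq_one_add_exp_ofReal_mul_I (x : ℝ) :
    Complex.normSq (1 + Complex.exp ((x : ℂ) * Complex.I)) = 2 + 2 * Real.cos x := by
  rw [Complex.normSq_add, Complex.normSq_exp_ofReal_mul_I, map_one, one_mul, Complex.conj_re,
    Complex.exp_ofReal_mul_I_re]
  ring

/-- If `(1/2)·e^{iθ}·(1 + e^{iπ/3})·(1 + e^{i(2α+π)}) = √2`, then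
`cos(α + π/2)² = 2/3`. -/
theorem cos_sq_eq_of_scalar_eq (α θ : ℝ)
    (h : (1 / 2 : ℂ) * Complex.exp ((θ : ℂ) * Complex.I)
        * (1 + Complex.exp ((↑(Real.pi / 3) : ℂ) * Complex.I))
        * (1 + Complex.exp ((↑(2 * α + Real.pi) : ℂ) * Complex.I))
        = (Real.sqrt 2 : ℂ)) :
    Real.cos (α + Real.pi / 2) ^ 2 = 2 / 3 := by
  have hn := congrArg Complex.normSq h
  have half : Complex.normSq (1 / 2 : ℂ) = 1 / 4 := by norm_num [map_div₀]
  rw [map_mul, map_mul, map_mul, half, Complex.normSq_exp_ofReal_mul_I,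
    Complex.normSq_one_add_exp_ofReal_mul_I, Complex.normSq_one_add_exp_ofReal_mul_I,
    Complex.normSq_ofReal, Real.mul_self_sqrt zero_le_two, Real.cos_pi_div_three] at hn
  rw [Real.cos_sq, show 2 * (α + Real.pi / 2) = 2 * α + Real.pi by ring]
  linarith
end
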